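/- Let M ≥ 1 and Kc ≥ 1 be integers and let z = (z₁, …, z_{Kc}) ∈ ℂ^{Kc} with z ≠ 0. Consider the feasible set F := {w ∈ M(𝕋) : ŵ[0] = 0 and ŵ[k] = z_k for k = 1, …, Kc}, which is nonempty. Then the total-variation norm ‖w‖_M attains its minimum over F at a unique w*, and there exist an integer N with 1 ≤ N ≤ 2·Kc, pairwise distinct points x₁, …, x_N ∈ 𝕋, and nonzero reals a₁, …, a_N with a₁ + ⋯ + a_N = 0 such that w* = Σₙ aₙ δ_{xₙ}. -/

import Mathlib

open MeasureTheory Filter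
open scoped ENNReal Real

noncomputable section

instance fact2pi : Fact (0 < 2 * Real.pi) := ⟨by positivity⟩

/-- The circle `𝕋 = ℝ/(2πℤ)`. -/
abbrev Circle2pi : Type := AddCircle (2 * Real.pi)

/-- Integral of a real function against a finite real signed (Radon) measure on `𝕋`. -/
noncomputable def sIntR (w : SignedMeasure Circle2pi) (f : Circle2pi → ℝ) : ℝ :=
  (∫ x, f x ∂w.toJordanDecomposition.posPart) - ∫ x, f x ∂w.toJordanDecomposition.negPart

/-- Integral of a complex function against a signed measure on `𝕋`. -/
noncomputable def sIntC (w : SignedMeasure Circle2pi) (f : Circle2pi → ℂ) : ℂ :=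
  (∫ x, f x ∂w.toJordanDecomposition.posPart) - ∫ x, f x ∂w.toJordanDecomposition.negPart

/-- Total-variation norm `‖w‖_M` of a signed measure on `𝕋`. -/
noncomputable def tvNorm (w : SignedMeasure Circle2pi) : ℝ :=
  (w.totalVariation Set.univ).toReal

/-- The `k`-th Fourier coefficient `ŵ[k] = ∫_𝕋 e^{-ikx} dw(x)` of a signed measure. -/
noncomputable def fCoeff (w : SignedMeasure Circle2pi) (k : ℤ) : ℂ :=
  sIntC w fun x => fourier (-k) x

/-- The Dirac measure `δ_x` as a signed measure. -/
noncomputable def diracSM (x : Circle2pi) : SignedMeasure Circle2pi :=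
  (MeasureTheory.Measure.dirac x).toSignedMeasure

end


lemma sum_ext_emb {ι κ F : Type*} [Fintype ι] [Fintype κ] [AddCommMonoid F] (e : ι ↪ κ)
    (g : ι → F) (h : κ → F)
    (h1 : ∀ i, h (e i) = g i) (h2 : ∀ j, (¬ ∃ i, e i = j) → h j = 0) :
    ∑ j, h j = ∑ i, g i := by
  symm
  apply Finset.sum_of_injOn e e.injective.injOn (by simp)
  · intro j _ hj
    apply h2
    simpa using hj
  · intro i _; exact (h1 i).symm

/-- Convex hull of a compact set in finite dimension is compact (Caratheodory). -/
lemma compact_hull {E : Type*} [NormedAddCommGroup E] [NormedSpace ℝ E] [FiniteDimensional ℝ E]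
    {s : Set E} (hs : IsCompact s) : IsCompact (convexHull ℝ s) := by
  set n := Module.finrank ℝ E + 1 with hn
  have key : convexHull ℝ s = (fun p : (Fin n → ℝ) × (Fin n → E) => ∑ i, p.1 i • p.2 i) ''
      (stdSimplex ℝ (Fin n) ×ˢ (Set.univ.pi fun _ => s)) := by
    apply Set.Subset.antisymm
    · intro x hx
      obtain ⟨ι, hι, z, w, hz, hai, hw, hw1, hx'⟩ := eq_pos_convex_span_of_mem_convexHull hx
      have hcard : Fintype.card ι ≤ Fintype.card (Fin n) := by
        rw [Fintype.card_fin, hn]; 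
        exact hai.card_le_finrank_succ.trans (Nat.succ_le_succ (Submodule.finrank_le _))
      obtain ⟨e⟩ := Function.Embedding.nonempty_of_card_le hcard
      have hne : Nonempty ι := by
        by_contra h
        rw [not_nonempty_iff] at h
        simp at hw1
      obtain ⟨i0⟩ := hne
      refine ⟨(Function.extend e w 0, Function.extend e z (fun _ => z i0)), ⟨⟨?_, ?_⟩, ?_⟩, ?_⟩
      · intro j
        by_cases hj : ∃ i, e i = j
        · obtain ⟨i, rfl⟩ := hj
          simp [e.injective.extend_apply, (hw i).le]
        · simp [Function.extend_apply' _ _ _ hj]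
      · rw [← hw1]
        apply sum_ext_emb e
        · intro i; simp [e.injective.extend_apply]
        · intro j hj; simp [Function.extend_apply' _ _ _ hj]
      · intro j _
        by_cases hj : ∃ i, e i = j
        · obtain ⟨i, rfl⟩ := hj
          simp only [e.injective.extend_apply]
          exact hz ⟨i, rfl⟩
        · simp only [Function.extend_apply' _ _ _ hj]
          exact hz ⟨i0, rfl⟩
      · rw [← hx']
        apply sum_ext_emb e
        · intro i; simp [e.injective.extend_apply]
        · intro j hj; simp [Function.extend_apply' _ _ _ hj]
    · rintro _ ⟨⟨w, v⟩, ⟨hw, hv⟩, rfl⟩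
      exact (convex_convexHull ℝ s).sum_mem (fun i _ => hw.1 i) hw.2
        (fun i _ => subset_convexHull ℝ s (hv i (Set.mem_univ _)))
  rw [key]
  apply ((isCompact_stdSimplex ℝ (Fin n)).prod (isCompact_univ_pi fun _ => hs)).image
  fun_prop

/-- The finite-dimensional moment space. -/
abbrev EE (K : ℕ) : Type := (Fin K → ℂ) × ℝ

/-- The moment curve. -/
noncomputable def phi (K : ℕ) (x : Circle2pi) : EE K :=
  (fun k => fourier (-(((k.1 : ℕ) : ℤ) + 1)) x, 1)

/-- The point on the complex unit circle. -/
noncomputable def uu (x : Circle2pi) : ℂ := (AddCircle.toCircle x : ℂ)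

lemma uu_ne (x : Circle2pi) : uu x ≠ 0 := by simp [uu]

lemma uu_inj : Function.Injective uu := by
  intro x y h
  exact AddCircle.injective_toCircle (by positivity) (Subtype.ext h)

lemma uu_conj (x : Circle2pi) : (starRingEnd ℂ) (uu x) = (uu x)⁻¹ := by
  simp [uu, ← Circle.coe_inv_eq_conj]

lemma uu_coe (t : ℝ) : uu (t : Circle2pi) = Complex.exp (t * Complex.I) := by
  simp [uu, AddCircle.toCircle_apply_mk, Circle.coe_exp]

lemma fourier_uu (n : ℤ) (x : Circle2pi) : fourier n x = uu x ^ n := by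
  rw [fourier_apply, AddCircle.toCircle_zsmul, Circle.coe_zpow, uu]

lemma phi_cont (K : ℕ) : Continuous (phi K) := by
  unfold phi
  fun_prop

lemma phi_indep (K n : ℕ) (hn : n ≤ 2 * K + 1) (x : Fin n → Circle2pi)
    (hx : Function.Injective x) (a : Fin n → ℝ) (h : ∑ i, a i • phi K (x i) = 0) : a = 0 := by
  have h1 : ∑ i, (a i : ℂ) = 0 := by
    have := congrArg Prod.snd h
    simp [phi, Prod.snd_sum] at this
    exact_mod_cast this
  have h2 : ∀ k : Fin K, ∑ i, (a i : ℂ) * (uu (x i) ^ (k.1 + 1))⁻¹ = 0 := by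
    intro k
    have := congrFun (congrArg Prod.fst h) k
    simp only [phi, Prod.fst_sum, Finset.sum_apply, Prod.smul_fst, Pi.smul_apply, fourier_uu] at this
    refine Eq.trans ?_ this
    apply Finset.sum_congr rfl
    intro i _
    rw [Complex.real_smul, zpow_neg]
    norm_cast
  have h3 : ∀ k : Fin K, ∑ i, (a i : ℂ) * (uu (x i) ^ (k.1 + 1)) = 0 := by
    intro k
    have := congrArg (starRingEnd ℂ) (h2 k)
    simpa [uu_conj] using this
  have hv := Matrix.eq_zero_of_forall_pow_sum_mul_pow_eq_zero (R := ℂ)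
    (f := fun i => uu (x i)) (v := fun i => (a i : ℂ) * (uu (x i) ^ K)⁻¹) (uu_inj.comp hx) ?_
  · funext i
    have := congrFun hv i
    simpa [uu_ne] using this
  · intro j
    rcases lt_trichotomy j.1 K with hj | hj | hj
    · rw [← h2 ⟨K - j.1 - 1, by omega⟩]
      apply Finset.sum_congr rfl
      intro i _
      have : uu (x i) ^ K = uu (x i) ^ (K - j.1 - 1 + 1) * uu (x i) ^ j.1 := by
        rw [← pow_add]; congr 1; omega
      rw [this]
      field_simp [uu_ne (x i)]
    · rw [← h1]
      apply Finset.sum_congr rfl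
      intro i _
      rw [hj]
      field_simp [uu_ne (x i)]
    · rw [← h3 ⟨j.1 - K - 1, by omega⟩]
      apply Finset.sum_congr rfl
      intro i _
      have : uu (x i) ^ j.1 = uu (x i) ^ (j.1 - K - 1 + 1) * uu (x i) ^ K := by
        rw [← pow_add]; congr 1; omega
      rw [this]
      field_simp [uu_ne (x i)]

lemma phi_indep_finset (K : ℕ) (S : Finset Circle2pi) (hS : S.card ≤ 2 * K + 1)
    (a : Circle2pi → ℝ) (h : ∑ x ∈ S, a x • phi K x = 0) : ∀ x ∈ S, a x = 0 := by
  have := phi_indep K S.card hS (fun i => (S.equivFin.symm i : Circle2pi))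
    (Subtype.val_injective.comp S.equivFin.symm.injective)
    (fun i => a (S.equivFin.symm i)) (by
      rw [← h, ← Finset.sum_coe_sort S]
      exact Equiv.sum_comp S.equivFin.symm (fun y : S => a y • phi K y))
  intro x hx
  have h2 := congrFun this (S.equivFin ⟨x, hx⟩)
  simpa using h2

lemma phi_span (K : ℕ) : Submodule.span ℝ (Set.range (phi K)) = ⊤ := by
  have : Infinite Circle2pi := by
    have : Infinite (Set.Ico (0:ℝ) (0 + 2 * Real.pi)) := Set.infinite_coe_iff.2 (Set.Ico_infinite (by positivity))
    exact Infinite.of_injective _ (AddCircle.equivIco (2 * Real.pi) 0).symm.injective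
  obtain ⟨x⟩ : Nonempty (Fin (2 * K + 1) ↪ Circle2pi) :=
    ⟨Function.Embedding.trans Fin.valEmbedding (Infinite.natEmbedding Circle2pi)⟩
  have hli : LinearIndependent ℝ (fun i => phi K (x i)) := by
    rw [Fintype.linearIndependent_iff]
    intro g hg
    exact congrFun (phi_indep K _ le_rfl x x.injective g hg)
  have hfr : Module.finrank ℝ (EE K) = 2 * K + 1 := by
    simp [Module.finrank_pi_fintype, Complex.finrank_real_complex, mul_comm]
  have := hli.span_eq_top_of_card_eq_finrank (by simp [hfr])
  rw [eq_top_iff, ← this]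
  apply Submodule.span_mono
  rintro _ ⟨i, rfl⟩
  exact ⟨x i, rfl⟩

/-- The symmetric convex body. -/
noncomputable def CC (K : ℕ) : Set (EE K) := convexHull ℝ (Set.range (phi K) ∪ Set.range (fun x => - phi K x))

lemma CC_compact (K : ℕ) : IsCompact (CC K) :=
  compact_hull ((isCompact_range (phi_cont K)).union (isCompact_range (phi_cont K).neg))

lemma CC_nhds (K : ℕ) : (0 : EE K) ∈ interior (CC K) := by
  have hne : (interior (CC K)).Nonempty := by
    rw [CC, interior_convexHull_nonempty_iff_affineSpan_eq_top,
      AffineSubspace.affineSpan_eq_top_iff_vectorSpan_eq_top_of_nonempty ℝ _ _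
        ⟨phi K 0, Or.inl ⟨0, rfl⟩⟩, eq_top_iff, ← phi_span K, Submodule.span_le]
    rintro _ ⟨x, rfl⟩
    have h1 := vsub_mem_vectorSpan ℝ (s := Set.range (phi K) ∪ Set.range (fun x => - phi K x))
      (Or.inl ⟨x, rfl⟩ : phi K x ∈ _) (Or.inr ⟨x, rfl⟩ : - phi K x ∈ _)
    have h2 := Submodule.smul_mem _ (1/2 : ℝ) h1
    convert h2 using 1
    rw [vsub_eq_sub, sub_neg_eq_add, ← two_smul ℝ, smul_smul]
    norm_num
  obtain ⟨v, hv⟩ := hne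
  have hsym : -(CC K) = CC K := by
    rw [CC, ← convexHull_neg]
    congr 1
    rw [Set.union_neg, Set.union_comm]
    congr 1 <;> ext y <;> simp [neg_eq_iff_eq_neg]
  have hv' : -v ∈ interior (CC K) := by
    rw [← hsym]
    have : interior (-(CC K)) = - interior (CC K) := by
      exact ((Homeomorph.neg (EE K)).preimage_interior (CC K)).symm
    rw [this]; simpa using hv
  have := (convex_convexHull ℝ _ : Convex ℝ (CC K)).interior hv hv' (a := 1/2) (b := 1/2)
    (by norm_num) (by norm_num) (by norm_num)
  simpa [CC] using this

/-- Supporting functional at the boundary. -/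
lemma dual_exists (K : ℕ) (y : EE K) (hy : y ≠ 0) :
    ∃ t : ℝ, 0 < t ∧ ∃ c ∈ CC K, y = t • c ∧ ∃ f : EE K →L[ℝ] ℝ, 0 < f c ∧
      ∀ x, |f (phi K x)| ≤ f c := by
  have h0 := CC_nhds K
  have hn : CC K ∈ nhds 0 := mem_interior_iff_mem_nhds.1 h0
  have hconv : Convex ℝ (CC K) := convex_convexHull ℝ _
  have habs : Absorbent ℝ (CC K) := absorbent_nhds_zero hn
  have hg : 0 < gauge (CC K) y :=
    (gauge_pos habs (NormedSpace.isVonNBounded_of_isBounded ℝ (CC_compact K).isBounded)).2 hy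
  set t := gauge (CC K) y with ht
  have h1 : gauge (CC K) (t⁻¹ • y) = 1 := by
    rw [gauge_smul_of_nonneg (by positivity), smul_eq_mul, ← ht]
    field_simp
  rw [gauge_eq_one_iff_mem_frontier hconv hn, (CC_compact K).isClosed.frontier_eq] at h1
  obtain ⟨f, hf⟩ := geometric_hahn_banach_open_point hconv.interior isOpen_interior h1.2
  have hle : ∀ a ∈ CC K, f a ≤ f (t⁻¹ • y) := by
    intro a ha
    have hcl : a ∈ closure (interior (CC K)) := by
      rw [hconv.closure_interior_eq_closure_of_nonempty_interior ⟨0, h0⟩]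
      exact subset_closure ha
    have : IsClosed {a | f a ≤ f (t⁻¹ • y)} := isClosed_le f.continuous continuous_const
    exact closure_minimal (fun b hb => (hf b hb).le) this hcl
  refine ⟨t, hg, t⁻¹ • y, h1.1, by rw [smul_smul, mul_inv_cancel₀ hg.ne', one_smul], f, ?_, ?_⟩
  · simpa using hf 0 h0
  · intro x
    rw [abs_le']
    refine ⟨hle _ (subset_convexHull ℝ _ (Or.inl ⟨x, rfl⟩)), ?_⟩
    rw [← map_neg]
    exact hle _ (subset_convexHull ℝ _ (Or.inr ⟨x, rfl⟩))

open Polynomial in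
lemma trig_poly (K : ℕ) (f : EE K →L[ℝ] ℝ) :
    ∃ P : ℂ[X], P.natDegree ≤ 2 * K ∧
      ∀ x, P.eval (uu x) = uu x ^ K * (f (phi K x) : ℂ) := by
  let A : Fin K → ℂ := fun k => (f (Pi.single k 1, 0) : ℂ)
  let B : Fin K → ℂ := fun k => (f (Pi.single k Complex.I, 0) : ℂ)
  refine ⟨C (f (0, 1) : ℂ) * X ^ K + ∑ k : Fin K,
    (C ((A k - Complex.I * B k) / 2) * X ^ (K - (k.1 + 1)) +
      C ((A k + Complex.I * B k) / 2) * X ^ (K + (k.1 + 1))), ?_, ?_⟩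
  · apply natDegree_add_le_of_degree_le
    · exact (natDegree_C_mul_X_pow_le _ _).trans (by omega)
    · apply natDegree_sum_le_of_forall_le
      intro k _
      have := k.2
      apply natDegree_add_le_of_degree_le
      · exact (natDegree_C_mul_X_pow_le _ _).trans (by omega)
      · exact (natDegree_C_mul_X_pow_le _ _).trans (by omega)
  · intro x
    have hdec : phi K x = ((0 : Fin K → ℂ), (1 : ℝ)) + ∑ k : Fin K,
        (((phi K x).1 k).re • ((Pi.single k 1 : Fin K → ℂ), (0 : ℝ)) +
          ((phi K x).1 k).im • ((Pi.single k Complex.I : Fin K → ℂ), (0 : ℝ))) := by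
      apply Prod.ext
      · funext j
        simp only [Prod.fst_add, Prod.fst_sum, Prod.smul_fst, Pi.add_apply, Finset.sum_apply,
          Pi.smul_apply, Pi.zero_apply, zero_add]
        rw [Finset.sum_eq_single j]
        · simp [Complex.re_add_im]
        · intro b _ hb
          simp [Pi.single_eq_of_ne hb.symm]
        · simp
      · simp [phi, Prod.snd_sum]
    have hfx : (f (phi K x) : ℂ) = (f (0, 1) : ℂ) + ∑ k : Fin K,
        ((((phi K x).1 k).re : ℂ) * A k + (((phi K x).1 k).im : ℂ) * B k) := by
      conv_lhs => rw [hdec]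
      simp only [map_add, map_sum, map_smul, smul_eq_mul]
      push_cast
      rfl
    rw [hfx]
    simp only [eval_add, eval_mul, eval_C, eval_pow, eval_X, eval_finsetSum]
    rw [mul_add, Finset.mul_sum, mul_comm (uu x ^ K)]
    congr 1
    apply Finset.sum_congr rfl
    intro k _
    have hk := k.2
    have hv : (phi K x).1 k = (uu x ^ (k.1 + 1))⁻¹ := by
      simp only [phi, fourier_uu, zpow_neg]
      norm_cast
    have hvc : (starRingEnd ℂ) ((phi K x).1 k) = uu x ^ (k.1 + 1) := by
      rw [hv]; simp [uu_conj]
    rw [Complex.re_eq_add_conj, Complex.im_eq_sub_conj, hvc, hv, pow_add (uu x) K (k.1 + 1)]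
    have : uu x ^ K = uu x ^ (K - (k.1 + 1)) * uu x ^ (k.1 + 1) := by
      rw [← pow_add]; congr 1; omega
    rw [this]
    have hne : uu x ^ (k.1 + 1) ≠ 0 := pow_ne_zero _ (uu_ne x)
    generalize uu x ^ (k.1 + 1) = v at *
    generalize uu x ^ (K - (k.1 + 1)) = q at *
    have hI : (1 : ℂ) / (2 * Complex.I) = - Complex.I / 2 := by
      field_simp
      simp
    rw [div_eq_mul_one_div (v⁻¹ - v), hI]
    field_simp
    ring

open Polynomial in
lemma extremal_finite (K : ℕ) (f : EE K →L[ℝ] ℝ) (m : ℝ)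
    (hle : ∀ x, |f (phi K x)| ≤ m)
    (hnc : ¬ ∃ c : ℝ, ∀ x, f (phi K x) = c) :
    ∃ S : Finset Circle2pi, S.card ≤ 2 * K ∧ ∀ x, |f (phi K x)| = m → x ∈ S := by
  obtain ⟨P, hPd, hP⟩ := trig_poly K f
  set R : ℂ[X] := (C (m : ℂ) * X ^ K) ^ 2 - P ^ 2 with hR
  have hRd : R.natDegree ≤ 4 * K := by
    refine (natDegree_sub_le _ _).trans (max_le ?_ ?_)
    · exact (natDegree_pow_le_of_le 2 (natDegree_C_mul_X_pow_le (m : ℂ) K)).trans (by omega)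
    · exact (natDegree_pow_le_of_le 2 hPd).trans (by omega)
  have hRe : ∀ x, R.eval (uu x) = uu x ^ (2 * K) * ((m ^ 2 - f (phi K x) ^ 2 : ℝ) : ℂ) := by
    intro x
    simp only [hR, eval_sub, eval_pow, eval_mul, eval_C, eval_X, hP]
    push_cast
    ring
  have hR0 : R ≠ 0 := by
    intro h
    apply hnc
    rw [hR, sub_eq_zero] at h
    rcases sq_eq_sq_iff_eq_or_eq_neg.1 h with h | h
    · refine ⟨m, fun x => ?_⟩
      have := hP x
      rw [← h] at this
      simp only [eval_mul, eval_C, eval_pow, eval_X] at this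
      rw [mul_comm] at this
      exact_mod_cast (mul_left_cancel₀ (pow_ne_zero _ (uu_ne x)) this).symm
    · refine ⟨-m, fun x => ?_⟩
      have := hP x
      rw [← neg_eq_iff_eq_neg.2 h] at this
      simp only [eval_neg, eval_mul, eval_C, eval_pow, eval_X] at this
      rw [mul_comm, ← mul_neg] at this
      exact_mod_cast (mul_left_cancel₀ (pow_ne_zero _ (uu_ne x)) this).symm
  have hroot : ∀ x, |f (phi K x)| = m → 1 < R.rootMultiplicity (uu x) := by
    intro x hx
    have hzero : R.eval (uu x) = 0 := by
      rw [hRe, ← hx, sq_abs]; simp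
    rw [one_lt_rootMultiplicity_iff_isRoot hR0]
    refine ⟨hzero, ?_⟩
    obtain ⟨t, rfl⟩ := QuotientAddGroup.mk_surjective x
    change |f (phi K (t : Circle2pi))| = m at hx
    change R.eval (uu (t : Circle2pi)) = 0 at hzero
    change (derivative R).eval (uu (t : Circle2pi)) = 0
    set h : ℝ → ℝ := fun s => m ^ 2 - f (phi K (s : Circle2pi)) ^ 2 with hh
    have hE : HasDerivAt (fun s : ℝ => Complex.exp (s * Complex.I))
        (Complex.exp (t * Complex.I) * Complex.I) t := by
      have h1 : HasDerivAt (fun s : ℝ => (s : ℂ) * Complex.I) Complex.I t := by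
        simpa using (Complex.ofRealCLM.hasDerivAt (x := t)).mul_const Complex.I
      exact h1.cexp
    have hRE := (R.hasDerivAt (Complex.exp (t * Complex.I))).comp t hE
    have hE2 := (hE.pow (2 * K)).inv (pow_ne_zero _ (Complex.exp_ne_zero _))
    have hH := hRE.mul hE2
    have hHeq : (fun s : ℝ => (h s : ℂ)) = (fun s : ℝ => R.eval (Complex.exp (s * Complex.I)) *
        (Complex.exp (s * Complex.I) ^ (2 * K))⁻¹) := by
      funext s
      rw [← uu_coe, hRe]
      field_simp [uu_ne]
      rfl
    have hH' := hH.congr_of_eventuallyEq (f₁ := fun s : ℝ => (h s : ℂ))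
      (Filter.Eventually.of_forall fun s => congrFun hHeq s)
    have hre := Complex.reCLM.hasFDerivAt.comp_hasDerivAt t hH'
    rw [show (Complex.reCLM ∘ fun s : ℝ => (h s : ℂ)) = h from rfl] at hre
    have hmin : IsLocalMin h t := by
      apply Filter.Eventually.of_forall
      intro s
      have := hle (s : Circle2pi)
      simp only [hh]
      rw [← hx] at this ⊢
      have h2 := sq_le_sq.2 (by rwa [abs_abs] : |f (phi K (s : Circle2pi))| ≤ |(|f (phi K (t : Circle2pi))|)|)
      rw [sq_abs] at *
      linarith
    have hd0 : HasDerivAt h 0 t := by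
      have := hmin.hasDerivAt_eq_zero hre
      rw [← this]; exact hre
    have hd0' : HasDerivAt (fun s : ℝ => (h s : ℂ)) 0 t := by
      simpa using hd0.ofReal_comp
    have huniq := hH'.unique hd0'
    rw [uu_coe] at hzero ⊢
    simpa [hzero] using huniq
  have hfin : {x | |f (phi K x)| = m}.Finite := by
    apply Set.Finite.of_finite_image (f := uu) _ uu_inj.injOn
    apply R.roots.toFinset.finite_toSet.subset
    rintro _ ⟨x, hx, rfl⟩
    have := hroot x hx
    simp only [Finset.mem_coe, Multiset.mem_toFinset, mem_roots hR0]
    exact (rootMultiplicity_pos hR0).1 (by omega)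
  refine ⟨hfin.toFinset, ?_, fun x hx => by simpa using hx⟩
  classical
  set T := hfin.toFinset.image uu with hT
  have hTc : T.card = hfin.toFinset.card := Finset.card_image_of_injective _ uu_inj
  have hle2 : 2 • T.val ≤ R.roots := by
    rw [Multiset.le_iff_count]
    intro a
    rw [Multiset.count_nsmul, count_roots]
    by_cases ha : a ∈ T
    · rw [Multiset.count_eq_one_of_mem T.nodup ha]
      obtain ⟨x, hx, rfl⟩ := Finset.mem_image.1 ha
      have := hroot x (by simpa using hx)
      omega
    · rw [Multiset.count_eq_zero_of_notMem ha]; simp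
  have h1 := Multiset.card_le_card hle2
  rw [Multiset.card_nsmul] at h1
  have h2 := R.card_roots'
  have h3 : T.val.card = T.card := rfl
  omega

/-- Moment vector of a signed measure. -/
noncomputable def mom (K : ℕ) (w : SignedMeasure Circle2pi) : EE K :=
  (∫ x, phi K x ∂w.toJordanDecomposition.posPart) - ∫ x, phi K x ∂w.toJordanDecomposition.negPart

lemma int_cont {F : Type*} [NormedAddCommGroup F] [NormedSpace ℝ F]
    (μ : Measure Circle2pi) [IsFiniteMeasure μ] (g : Circle2pi → F) (hg : Continuous g) :
    Integrable g μ := by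
  obtain ⟨C, hC⟩ := isCompact_univ.exists_bound_of_continuousOn hg.continuousOn
  have hs : HasCompactSupport g := HasCompactSupport.of_compactSpace g
  exact hg.integrable_of_hasCompactSupport hs

lemma tv_eq (w : SignedMeasure Circle2pi) : tvNorm w =
    w.toJordanDecomposition.posPart.real Set.univ + w.toJordanDecomposition.negPart.real Set.univ := by
  rw [tvNorm, SignedMeasure.totalVariation, Measure.add_apply, ENNReal.toReal_add (by simp) (by simp)]
  rfl

lemma mom_feas (K : ℕ) (z : Fin K → ℂ) (w : SignedMeasure Circle2pi) :
    (w Set.univ = 0 ∧ ∀ k : Fin K, fCoeff w ((k.1 : ℤ) + 1) = z k) ↔ mom K w = (z, 0) := by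
  have hi := fun (μ : Measure Circle2pi) [IsFiniteMeasure μ] => int_cont μ (phi K) (phi_cont K)
  have h1 : (mom K w).2 = w Set.univ := by
    rw [mom, Prod.snd_sub, snd_integral (hi _), snd_integral (hi _),
      SignedMeasure.apply_eq_posPart_real_sub_negPart_real _ MeasurableSet.univ]
    simp [phi]
  have h2 : ∀ k : Fin K, (mom K w).1 k = fCoeff w ((k.1 : ℤ) + 1) := by
    intro k
    rw [mom, Prod.fst_sub, fst_integral (hi _), fst_integral (hi _), Pi.sub_apply,
      eval_integral, eval_integral]
    · rfl
    · intro i; exact int_cont _ _ ((continuous_apply i).comp (continuous_fst.comp (phi_cont K)))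
    · intro i; exact int_cont _ _ ((continuous_apply i).comp (continuous_fst.comp (phi_cont K)))
  rw [Prod.ext_iff, funext_iff, h1]
  simp only [h2]
  exact and_comm

lemma exists_meas (K : ℕ) (c : EE K) (hc : c ∈ CC K) :
    ∃ μ ν : Measure Circle2pi, IsFiniteMeasure μ ∧ IsFiniteMeasure ν ∧
      (∫ x, phi K x ∂μ) - (∫ x, phi K x ∂ν) = c ∧ μ.real Set.univ + ν.real Set.univ ≤ 1 := by
  have hsub : CC K ⊆ {c | ∃ μ ν : Measure Circle2pi, IsFiniteMeasure μ ∧ IsFiniteMeasure ν ∧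
      (∫ x, phi K x ∂μ) - (∫ x, phi K x ∂ν) = c ∧ μ.real Set.univ + ν.real Set.univ ≤ 1} := by
    apply convexHull_min
    · rintro _ (⟨x, rfl⟩ | ⟨x, rfl⟩)
      · exact ⟨Measure.dirac x, 0, inferInstance, inferInstance, by simp, by simp⟩
      · exact ⟨0, Measure.dirac x, inferInstance, inferInstance, by simp, by simp⟩
    · rintro _ ⟨μ, ν, hμ, hν, rfl, h1⟩ _ ⟨μ', ν', hμ', hν', rfl, h2⟩ a b ha hb hab
      lift a to NNReal using ha
      lift b to NNReal using hb
      refine ⟨a • μ + b • μ', a • ν + b • ν', inferInstance, inferInstance, ?_, ?_⟩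
      · have hi := fun (μ : Measure Circle2pi) [IsFiniteMeasure μ] => int_cont μ (phi K) (phi_cont K)
        rw [integral_add_measure (hi _) (hi _), integral_add_measure (hi _) (hi _)]
        simp only [integral_smul_nnreal_measure, NNReal.smul_def]
        module
      · rw [measureReal_add_apply, measureReal_add_apply]
        simp only [measureReal_nnreal_smul_apply]
        have ha := a.2
        have hb := b.2
        nlinarith [mul_le_mul_of_nonneg_left h1 a.2, mul_le_mul_of_nonneg_left h2 b.2]
  exact hsub hc

lemma sm_of_meas (K : ℕ) (μ ν : Measure Circle2pi) [IsFiniteMeasure μ] [IsFiniteMeasure ν] :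
    ∃ w : SignedMeasure Circle2pi, mom K w = (∫ x, phi K x ∂μ) - (∫ x, phi K x ∂ν) ∧
      tvNorm w ≤ μ.real Set.univ + ν.real Set.univ := by
  set w := μ.toSignedMeasure - ν.toSignedMeasure with hw
  have hi := fun (μ : Measure Circle2pi) [IsFiniteMeasure μ] => int_cont μ (phi K) (phi_cont K)
  refine ⟨w, ?_, ?_⟩
  · have hJ := w.toSignedMeasure_toJordanDecomposition
    have : w.toJordanDecomposition.posPart + ν = μ + w.toJordanDecomposition.negPart := by
      rw [← Measure.toSignedMeasure_eq_toSignedMeasure_iff, Measure.toSignedMeasure_add,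
        Measure.toSignedMeasure_add, ← sub_eq_sub_iff_add_eq_add]
      exact hJ
    have h2 := congrArg (fun ρ => ∫ x, phi K x ∂ρ) this
    beta_reduce at h2
    rw [integral_add_measure (hi _) (hi _), integral_add_measure (hi _) (hi _)] at h2
    rw [mom, sub_eq_sub_iff_add_eq_add]
    exact h2
  · rw [tv_eq, hw, Measure.toJordanDecomposition_toSignedMeasure_sub]
    apply add_le_add
    · exact ENNReal.toReal_mono (by simp) (Measure.sub_le _)
    · exact ENNReal.toReal_mono (by simp) (Measure.sub_le _)

lemma f_mom (K : ℕ) (f : EE K →L[ℝ] ℝ) (w : SignedMeasure Circle2pi) :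
    f (mom K w) = (∫ x, f (phi K x) ∂w.toJordanDecomposition.posPart)
      - ∫ x, f (phi K x) ∂w.toJordanDecomposition.negPart := by
  have hi := fun (μ : Measure Circle2pi) [IsFiniteMeasure μ] => int_cont μ (phi K) (phi_cont K)
  rw [mom, map_sub, f.integral_comp_comm (hi _), f.integral_comp_comm (hi _)]

lemma gap (K : ℕ) (f : EE K →L[ℝ] ℝ) (m : ℝ) (w : SignedMeasure Circle2pi) :
    m * tvNorm w - f (mom K w) = (∫ x, (m - f (phi K x)) ∂w.toJordanDecomposition.posPart)
      + ∫ x, (m + f (phi K x)) ∂w.toJordanDecomposition.negPart := by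
  have hi := fun (μ : Measure Circle2pi) [IsFiniteMeasure μ] =>
    int_cont μ (fun x => f (phi K x)) (f.continuous.comp (phi_cont K))
  rw [integral_sub (integrable_const _) (hi _), integral_add (integrable_const _) (hi _), f_mom, tv_eq]
  simp
  ring

lemma tv_lower (K : ℕ) (f : EE K →L[ℝ] ℝ) (m : ℝ) (hle : ∀ x, |f (phi K x)| ≤ m)
    (w : SignedMeasure Circle2pi) : f (mom K w) ≤ m * tvNorm w := by
  have := gap K f m w
  have h1 : 0 ≤ ∫ x, (m - f (phi K x)) ∂w.toJordanDecomposition.posPart :=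
    integral_nonneg fun x => by have := abs_le.1 (hle x); simp; linarith
  have h2 : 0 ≤ ∫ x, (m + f (phi K x)) ∂w.toJordanDecomposition.negPart :=
    integral_nonneg fun x => by have := abs_le.1 (hle x); simp; linarith
  linarith

lemma tv_supp (K : ℕ) (f : EE K →L[ℝ] ℝ) (m : ℝ) (hle : ∀ x, |f (phi K x)| ≤ m)
    (w : SignedMeasure Circle2pi) (h : f (mom K w) = m * tvNorm w) (hm : 0 < m) :
    (∀ᵐ x ∂w.toJordanDecomposition.posPart, |f (phi K x)| = m) ∧
    (∀ᵐ x ∂w.toJordanDecomposition.negPart, |f (phi K x)| = m) := by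
  have := gap K f m w
  have p1 : ∀ x, 0 ≤ m - f (phi K x) := fun x => by have := abs_le.1 (hle x); linarith
  have p2 : ∀ x, 0 ≤ m + f (phi K x) := fun x => by have := abs_le.1 (hle x); linarith
  have h1 : 0 ≤ ∫ x, (m - f (phi K x)) ∂w.toJordanDecomposition.posPart :=
    integral_nonneg p1
  have h2 : 0 ≤ ∫ x, (m + f (phi K x)) ∂w.toJordanDecomposition.negPart :=
    integral_nonneg p2
  have hc := phi_cont K
  have e1 := (integral_eq_zero_iff_of_nonneg p1 (int_cont _ _ (by fun_prop))).1
    (by linarith : ∫ x, (m - f (phi K x)) ∂w.toJordanDecomposition.posPart = 0)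
  have e2 := (integral_eq_zero_iff_of_nonneg p2 (int_cont _ _ (by fun_prop))).1
    (by linarith : ∫ x, (m + f (phi K x)) ∂w.toJordanDecomposition.negPart = 0)
  constructor
  · filter_upwards [e1] with x hx
    simp only [Pi.zero_apply] at hx
    rw [show f (phi K x) = m by linarith, abs_of_pos hm]
  · filter_upwards [e2] with x hx
    simp only [Pi.zero_apply] at hx
    rw [show f (phi K x) = -m by linarith, abs_neg, abs_of_pos hm]

lemma vm_sum_apply {ι : Type*} (S : Finset ι) (v : ι → SignedMeasure Circle2pi) (A : Set Circle2pi) :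
    (∑ i ∈ S, v i) A = ∑ i ∈ S, v i A := by
  classical
  induction S using Finset.induction_on with
  | empty => simp
  | insert i S hi ih => rw [Finset.sum_insert hi, Finset.sum_insert hi, add_apply, ih]

lemma discrete (K : ℕ) (w : SignedMeasure Circle2pi) (S : Finset Circle2pi)
    (h1 : ∀ᵐ x ∂w.toJordanDecomposition.posPart, x ∈ S)
    (h2 : ∀ᵐ x ∂w.toJordanDecomposition.negPart, x ∈ S) :
    mom K w = ∑ x ∈ S, w {x} • phi K x ∧ w = ∑ x ∈ S, w {x} • diracSM x := by
  rw [Measure.ae_mem_finset_iff] at h1 h2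
  have hx : ∀ x, w {x} = w.toJordanDecomposition.posPart.real {x}
      - w.toJordanDecomposition.negPart.real {x} := fun x =>
    SignedMeasure.apply_eq_posPart_real_sub_negPart_real _ (measurableSet_singleton x)
  have key : ∀ (F : Type) [NormedAddCommGroup F] [NormedSpace ℝ F] [CompleteSpace F]
      (μ : Measure Circle2pi) [IsFiniteMeasure μ] (g : Circle2pi → F),
      μ = ∑ a ∈ S, μ {a} • .dirac a → ∫ x, g x ∂μ = ∑ x ∈ S, μ.real {x} • g x := by
    intro F _ _ _ μ _ g hμ
    conv_lhs => rw [hμ]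
    rw [integral_finsetSum_measure]
    · apply Finset.sum_congr rfl
      intro x _
      rw [integral_smul_measure, integral_dirac]
      rfl
    · intro i _
      exact (integrable_dirac (by simp)).smul_measure (by simp)
  have key2 : ∀ (μ : Measure Circle2pi) [IsFiniteMeasure μ] (A : Set Circle2pi), MeasurableSet A →
      μ = ∑ a ∈ S, μ {a} • .dirac a → μ.real A = ∑ x ∈ S, μ.real {x} * (diracSM x) A := by
    intro μ _ A hA hμ
    have hd : ∀ x, (diracSM x) A = A.indicator (fun _ => (1 : ℝ)) x := by
      intro x
      rw [diracSM, Measure.toSignedMeasure_apply_measurable hA, measureReal_def,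
        Measure.dirac_apply' _ hA]
      by_cases hx : x ∈ A <;> simp [hx]
    have := key ℝ μ (A.indicator (fun _ => (1 : ℝ))) hμ
    rw [integral_indicator hA] at this
    simpa [hd] using this
  constructor
  · rw [mom, key _ _ _ h1, key _ _ _ h2, ← Finset.sum_sub_distrib]
    apply Finset.sum_congr rfl
    intro x _
    rw [hx, sub_smul]
  · ext A hA
    rw [SignedMeasure.apply_eq_posPart_real_sub_negPart_real _ hA, key2 _ A hA h1, key2 _ A hA h2,
      ← Finset.sum_sub_distrib]
    rw [vm_sum_apply]
    apply Finset.sum_congr rfl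
    intro x _
    rw [smul_apply, hx, smul_eq_mul, sub_mul]

/-- For `z ∈ ℂ^{Kc} \ {0}`, the feasible set
`F = {w ∈ M(𝕋) : ŵ[0] = 0, ŵ[k] = z_k (1 ≤ k ≤ Kc)}` is nonempty, the TV norm attains its
minimum over `F` at a unique `w*`, and `w*` is a sum of `N` Diracs with `1 ≤ N ≤ 2·Kc`,
at pairwise distinct points, with nonzero amplitudes summing to zero. -/
theorem stmt1 (M Kc : ℕ) (hM : 1 ≤ M) (hKc : 1 ≤ Kc) (z : Fin Kc → ℂ) (hz : z ≠ 0) :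
    (∃ w : SignedMeasure Circle2pi,
      w Set.univ = 0 ∧ ∀ k : Fin Kc, fCoeff w ((k.1 : ℤ) + 1) = z k) ∧
    ∃ wstar : SignedMeasure Circle2pi,
      (wstar Set.univ = 0 ∧ ∀ k : Fin Kc, fCoeff wstar ((k.1 : ℤ) + 1) = z k) ∧
      (∀ w : SignedMeasure Circle2pi,
        (w Set.univ = 0 ∧ ∀ k : Fin Kc, fCoeff w ((k.1 : ℤ) + 1) = z k) →
        tvNorm wstar ≤ tvNorm w) ∧
      (∀ w : SignedMeasure Circle2pi,
        (w Set.univ = 0 ∧ ∀ k : Fin Kc, fCoeff w ((k.1 : ℤ) + 1) = z k) →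
        tvNorm w = tvNorm wstar → w = wstar) ∧
      ∃ N : ℕ, 1 ≤ N ∧ N ≤ 2 * Kc ∧
        ∃ (x : Fin N → Circle2pi) (amp : Fin N → ℝ),
          Function.Injective x ∧ (∀ n, amp n ≠ 0) ∧ (∑ n, amp n) = 0 ∧
            wstar = ∑ n, amp n • diracSM (x n) := by
  have hy : ((z, 0) : EE Kc) ≠ 0 := fun h => hz (congrArg Prod.fst h)
  obtain ⟨t, ht, c, hc, hyc, f, hfc, hle⟩ := dual_exists Kc (z, 0) hy
  obtain ⟨μ, ν, hμ, hν, hmc, hmass⟩ := exists_meas Kc c hc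
  lift t to NNReal using ht.le
  obtain ⟨w, hwm, hwt⟩ := sm_of_meas Kc (t • μ) (t • ν)
  have hwy : mom Kc w = (z, 0) := by
    rw [hwm, integral_smul_nnreal_measure, integral_smul_nnreal_measure, ← smul_sub, hmc, hyc]
    rfl
  have hwt' : tvNorm w ≤ t := by
    refine hwt.trans ?_
    simp only [measureReal_nnreal_smul_apply]
    nlinarith [mul_le_mul_of_nonneg_left hmass t.2]
  have hfy : f ((z, 0) : EE Kc) = f c * t := by
    rw [hyc, map_smul, smul_eq_mul, mul_comm]
  have hlow : ∀ v : SignedMeasure Circle2pi, mom Kc v = (z, 0) → (t : ℝ) ≤ tvNorm v := by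
    intro v hv
    have := tv_lower Kc f (f c) hle v
    rw [hv, hfy] at this
    exact le_of_mul_le_mul_left this hfc
  have hwtv : tvNorm w = t := le_antisymm hwt' (hlow w hwy)
  have hnc : ¬ ∃ c : ℝ, ∀ x, f (phi Kc x) = c := by
    rintro ⟨b, hb⟩
    have h1 := f_mom Kc f w
    have h2 := ((mom_feas Kc z w).2 hwy).1
    rw [SignedMeasure.apply_eq_posPart_real_sub_negPart_real _ MeasurableSet.univ] at h2
    simp only [hb, integral_const, smul_eq_mul] at h1
    rw [← sub_mul, h2, zero_mul, hwy, hfy] at h1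
    exact (mul_pos hfc ht).ne' h1
  obtain ⟨S, hSc, hS⟩ := extremal_finite Kc f (f c) hle hnc
  have hdisc : ∀ v : SignedMeasure Circle2pi, mom Kc v = (z, 0) → tvNorm v = t →
      mom Kc v = ∑ x ∈ S, v {x} • phi Kc x ∧ v = ∑ x ∈ S, v {x} • diracSM x := by
    intro v hv hvt
    obtain ⟨h1, h2⟩ := tv_supp Kc f (f c) hle v (by rw [hv, hfy, hvt]) hfc
    exact discrete Kc v S (h1.mono fun x hx => hS x hx) (h2.mono fun x hx => hS x hx)
  obtain ⟨hw1, hw2⟩ := hdisc w hwy hwtv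
  refine ⟨⟨w, (mom_feas Kc z w).2 hwy⟩, w, (mom_feas Kc z w).2 hwy, ?_, ?_, ?_⟩
  · intro v hv
    rw [hwtv]
    exact hlow v ((mom_feas Kc z v).1 hv)
  · intro v hv hvt
    have hvy := (mom_feas Kc z v).1 hv
    obtain ⟨hv1, hv2⟩ := hdisc v hvy (hvt.trans hwtv)
    have := phi_indep_finset Kc S (by omega) (fun x => v {x} - w {x}) (by
      simp only [sub_smul, Finset.sum_sub_distrib]
      rw [← hv1, ← hw1, hvy, hwy, sub_self])
    refine hv2.trans (Eq.trans ?_ hw2.symm)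
    apply Finset.sum_congr rfl
    intro x hx
    rw [sub_eq_zero.1 (this x hx)]
  · classical
    set T := S.filter (fun x => w {x} ≠ 0) with hT
    have hwT : w = ∑ x ∈ T, w {x} • diracSM x := by
      conv_lhs => rw [hw2]
      symm
      apply Finset.sum_subset (Finset.filter_subset _ _)
      intro x hxS hxT
      have : w {x} = 0 := by
        by_contra h
        exact hxT (Finset.mem_filter.2 ⟨hxS, h⟩)
      rw [this, zero_smul]
    have hwF : w = ∑ n : Fin T.card, w {(T.equivFin.symm n : Circle2pi)} •
        diracSM (T.equivFin.symm n : Circle2pi) := by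
      conv_lhs => rw [hwT]
      rw [← Finset.sum_coe_sort T]
      exact (Equiv.sum_comp T.equivFin.symm (fun y : T => w {(y : Circle2pi)} • diracSM y)).symm
    refine ⟨T.card, ?_, (Finset.card_filter_le _ _).trans hSc,
      fun n => (T.equivFin.symm n : Circle2pi), fun n => w {(T.equivFin.symm n : Circle2pi)},
      Subtype.val_injective.comp T.equivFin.symm.injective, ?_, ?_, hwF⟩
    · rw [Nat.one_le_iff_ne_zero, Ne, Finset.card_eq_zero]
      intro hTe
      apply hy
      rw [← hwy, hw1]
      apply Finset.sum_eq_zero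
      intro x hx
      have : w {x} = 0 := by
        by_contra h
        have : x ∈ T := Finset.mem_filter.2 ⟨hx, h⟩
        simp [hTe] at this
      rw [this, zero_smul]
    · intro n
      exact (Finset.mem_filter.1 (T.equivFin.symm n).2).2
    · have h0 := ((mom_feas Kc z w).2 hwy).1
      rw [hwF] at h0
      rw [vm_sum_apply] at h0
      rw [← h0]
      apply Finset.sum_congr rfl
      intro n _
      rw [smul_apply, diracSM,
        Measure.toSignedMeasure_apply_measurable MeasurableSet.univ]
      simp
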